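/- arXiv:2601.18840 — 3 statements merged into one kernel-verified Lean document; each statement's English description precedes it below -/
import Mathlib

section
/- Let Q* : S × A → ℝ satisfy T Q* = Q*, let n = (card S)·(card A), let Φ be a feature matrix, and define f(θ) = (1/2)·‖T Q_θ − Q_θ‖₂². If θ* : Fin m → ℝ is a global minimizer of f (f(θ*) ≤ f(θ) for all θ), then ‖Q_{θ*} − Q*‖∞ ≤ ((1+γ)·√n/(1−γ))·d, where d is the Euclidean (ℓ2) distance from Q* to the set {Q_θ : θ ∈ Fin m → ℝ}, i.e. d = inf_θ ‖Q_θ − Q*‖₂. -/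
noncomputable def supNorm {S A : Type*} [Fintype S] [Fintype A] [Nonempty S] [Nonempty A]
    (Q : S × A → ℝ) : ℝ :=
  Finset.univ.sup' Finset.univ_nonempty fun p => |Q p|

noncomputable def l2Norm {S A : Type*} [Fintype S] [Fintype A] (Q : S × A → ℝ) : ℝ :=
  Real.sqrt (∑ p : S × A, (Q p) ^ 2)

/-- The control Bellman operator `T`. -/
noncomputable def bellT {S A : Type*} [Fintype S] [Fintype A] [Nonempty A]
    (P : S → A → S → ℝ) (R : S → A → ℝ) (γ : ℝ) (Q : S × A → ℝ) : S × A → ℝ :=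
  fun p => R p.1 p.2 + γ * ∑ s' : S, P p.1 p.2 s' *
    (Finset.univ.sup' Finset.univ_nonempty fun a' : A => Q (s', a'))

section Norms

variable {S A : Type*} [Fintype S] [Fintype A]

theorem l2Norm_nonneg (Q : S × A → ℝ) : 0 ≤ l2Norm Q := Real.sqrt_nonneg _

variable [Nonempty S] [Nonempty A]

theorem abs_le_supNorm (Q : S × A → ℝ) (p : S × A) : |Q p| ≤ supNorm Q :=
  Finset.le_sup' (fun p => |Q p|) (Finset.mem_univ p)

theorem supNorm_nonneg (Q : S × A → ℝ) : 0 ≤ supNorm Q :=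
  (abs_nonneg _).trans (abs_le_supNorm Q (Classical.arbitrary _))

theorem supNorm_le {Q : S × A → ℝ} {c : ℝ} (h : ∀ p, |Q p| ≤ c) : supNorm Q ≤ c :=
  Finset.sup'_le _ _ fun p _ => h p

theorem supNorm_le_l2Norm (Q : S × A → ℝ) : supNorm Q ≤ l2Norm Q :=
  supNorm_le fun p => Real.abs_le_sqrt <|
    Finset.single_le_sum (f := fun p => Q p ^ 2) (fun _ _ => sq_nonneg _) (Finset.mem_univ p)

theorem l2Norm_le_sqrt_card_mul_supNorm (Q : S × A → ℝ) :
    l2Norm Q ≤ Real.sqrt ((Fintype.card S * Fintype.card A : ℕ) : ℝ) * supNorm Q := by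
  rw [← Real.sqrt_sq (supNorm_nonneg Q), ← Real.sqrt_mul (Nat.cast_nonneg _)]
  refine Real.sqrt_le_sqrt ?_
  calc ∑ p : S × A, Q p ^ 2 ≤ ∑ _p : S × A, supNorm Q ^ 2 :=
        Finset.sum_le_sum fun p _ => sq_le_sq.2 <| by
          rw [abs_of_nonneg (supNorm_nonneg Q)]; exact abs_le_supNorm Q p
    _ = _ := by simp [Fintype.card_prod]

theorem abs_sup'_sub_sup'_le {f g : A → ℝ} {c : ℝ} (h : ∀ a, |f a - g a| ≤ c) :
    |Finset.univ.sup' Finset.univ_nonempty f - Finset.univ.sup' Finset.univ_nonempty g| ≤ c := by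
  rw [abs_sub_le_iff, sub_le_iff_le_add, sub_le_iff_le_add]
  constructor <;> refine Finset.sup'_le _ _ fun a _ => ?_
  · linarith [(abs_le.1 (h a)).2, Finset.le_sup' g (Finset.mem_univ a)]
  · linarith [(abs_le.1 (h a)).1, Finset.le_sup' f (Finset.mem_univ a)]

variable {P : S → A → S → ℝ} {γ : ℝ}

/-- The control Bellman operator is a `γ`-contraction in the sup norm. -/
theorem abs_bellT_sub_bellT_le (R : S → A → ℝ)
    (hP0 : ∀ s a s', 0 ≤ P s a s') (hP1 : ∀ s a, ∑ s' : S, P s a s' = 1) (hγ0 : 0 ≤ γ)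
    (Q Q' : S × A → ℝ) (p : S × A) :
    |bellT P R γ Q p - bellT P R γ Q' p| ≤ γ * supNorm (fun p => Q p - Q' p) := by
  simp only [bellT, add_sub_add_left_eq_sub, ← mul_sub, ← Finset.sum_sub_distrib]
  rw [abs_mul, abs_of_nonneg hγ0]
  refine mul_le_mul_of_nonneg_left ?_ hγ0
  calc _ ≤ _ := Finset.abs_sum_le_sum_abs _ _
    _ ≤ ∑ s' : S, P p.1 p.2 s' * supNorm (fun p => Q p - Q' p) :=
        Finset.sum_le_sum fun s' _ => by
          rw [abs_mul, abs_of_nonneg (hP0 _ _ _)]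
          exact mul_le_mul_of_nonneg_left
            (abs_sup'_sub_sup'_le fun a => abs_le_supNorm (fun p => Q p - Q' p) (s', a))
            (hP0 _ _ _)
    _ = _ := by rw [← Finset.sum_mul, hP1, one_mul]

variable {R : S → A → ℝ} {Qstar : S × A → ℝ}

theorem supNorm_sub_fixed_le_residual
    (hP0 : ∀ s a s', 0 ≤ P s a s') (hP1 : ∀ s a, ∑ s' : S, P s a s' = 1) (hγ0 : 0 ≤ γ)
    (hfix : bellT P R γ Qstar = Qstar) (Q : S × A → ℝ) :
    (1 - γ) * supNorm (fun p => Q p - Qstar p) ≤ supNorm (fun p => bellT P R γ Q p - Q p) := by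
  suffices supNorm (fun p => Q p - Qstar p) ≤
      supNorm (fun p => bellT P R γ Q p - Q p) + γ * supNorm (fun p => Q p - Qstar p) by linarith
  refine supNorm_le fun p => ?_
  have hT := abs_bellT_sub_bellT_le R hP0 hP1 hγ0 Q Qstar p
  have hres := abs_le_supNorm (fun p => bellT P R γ Q p - Q p) p
  rw [hfix] at hT
  have htri := abs_sub_le (Q p) (bellT P R γ Q p) (Qstar p)
  rw [abs_sub_comm (Q p) (bellT P R γ Q p)] at htri
  linarith

theorem supNorm_residual_le
    (hP0 : ∀ s a s', 0 ≤ P s a s') (hP1 : ∀ s a, ∑ s' : S, P s a s' = 1) (hγ0 : 0 ≤ γ)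
    (hfix : bellT P R γ Qstar = Qstar) (Q : S × A → ℝ) :
    supNorm (fun p => bellT P R γ Q p - Q p) ≤ (1 + γ) * supNorm (fun p => Q p - Qstar p) := by
  refine supNorm_le fun p => ?_
  have hT := abs_bellT_sub_bellT_le R hP0 hP1 hγ0 Q Qstar p
  have hQ := abs_le_supNorm (fun p => Q p - Qstar p) p
  rw [hfix] at hT
  have htri := abs_sub_le (bellT P R γ Q p) (Qstar p) (Q p)
  rw [abs_sub_comm (Qstar p) (Q p)] at htri
  linarith

end Norms

theorem stmt12 {S A : Type*} [Fintype S] [Fintype A] [Nonempty S] [Nonempty A] {m : ℕ}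
    (P : S → A → S → ℝ) (R : S → A → ℝ) (γ : ℝ)
    (hP0 : ∀ s a s', 0 ≤ P s a s') (hP1 : ∀ s a, ∑ s' : S, P s a s' = 1)
    (hγ0 : 0 ≤ γ) (hγ1 : γ < 1)
    (Qstar : S × A → ℝ) (hfix : bellT P R γ Qstar = Qstar)
    (Φ : Matrix (S × A) (Fin m) ℝ) (θstar : Fin m → ℝ)
    (hmin : ∀ θ : Fin m → ℝ,
      (1 / 2) * (l2Norm (fun p => bellT P R γ (Φ.mulVec θstar) p - Φ.mulVec θstar p)) ^ 2
        ≤ (1 / 2) * (l2Norm (fun p => bellT P R γ (Φ.mulVec θ) p - Φ.mulVec θ p)) ^ 2) :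
    supNorm (fun p => Φ.mulVec θstar p - Qstar p)
      ≤ ((1 + γ) * Real.sqrt ((Fintype.card S * Fintype.card A : ℕ) : ℝ) / (1 - γ)) *
        (⨅ θ : Fin m → ℝ, l2Norm (fun p => Φ.mulVec θ p - Qstar p)) := by
  have hγ : 0 < 1 - γ := sub_pos.2 hγ1
  rw [Real.mul_iInf_of_nonneg (by positivity)]
  refine le_ciInf fun θ => ?_
  rw [div_mul_eq_mul_div, le_div_iff₀ hγ, mul_comm]
  have hres : l2Norm (fun p => bellT P R γ (Φ.mulVec θstar) p - Φ.mulVec θstar p) ≤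
      l2Norm (fun p => bellT P R γ (Φ.mulVec θ) p - Φ.mulVec θ p) :=
    (pow_le_pow_iff_left₀ (l2Norm_nonneg _) (l2Norm_nonneg _) two_ne_zero).1 (by linarith [hmin θ])
  calc _ ≤ _ := supNorm_sub_fixed_le_residual hP0 hP1 hγ0 hfix _
    _ ≤ _ := supNorm_le_l2Norm _
    _ ≤ _ := hres
    _ ≤ _ := l2Norm_le_sqrt_card_mul_supNorm _
    _ ≤ Real.sqrt ((Fintype.card S * Fintype.card A : ℕ) : ℝ) *
        ((1 + γ) * l2Norm (fun p => Φ.mulVec θ p - Qstar p)) := by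
      gcongr
      exact (supNorm_residual_le hP0 hP1 hγ0 hfix _).trans
        (mul_le_mul_of_nonneg_left (supNorm_le_l2Norm _) (by linarith))
    _ = _ := by ring
end

section
/- Fix λ > 0, define f(Q) = (1/2)·‖F_λ Q − Q‖₂², and let Q*_λ satisfy F_λ Q*_λ = Q*_λ (so f(Q*_λ) = 0). Then for every compact set C ⊆ (S × A → ℝ) there exists a constant L > 0 such that for all Q ∈ C, f(Q) − f(Q*_λ) ≤ L·‖(γ·M_{π_Q} − I)ᵀ·(F_λ Q − Q)‖₂² (a Polyak–Łojasiewicz inequality, the right-hand side being L times the squared Euclidean norm of the gradient of f at Q). -/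
/-- The soft control Bellman operator `F_λ`. -/
noncomputable def softT {S A : Type*} [Fintype S] [Fintype A]
    (P : S → A → S → ℝ) (R : S → A → ℝ) (γ lam : ℝ) (Q : S × A → ℝ) : S × A → ℝ :=
  fun p => R p.1 p.2 + γ * ∑ s' : S, P p.1 p.2 s' *
    (lam * Real.log (∑ a' : A, Real.exp (Q (s', a') / lam)))

/-- The Boltzmann policy of `Q` at temperature `lam`. -/
noncomputable def boltzmann {S A : Type*} [Fintype A]
    (lam : ℝ) (Q : S × A → ℝ) (s : S) (a : A) : ℝ :=
  Real.exp (Q (s, a) / lam) / ∑ u : A, Real.exp (Q (s, u) / lam)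

lemma l2Norm_sq {S A : Type*} [Fintype S] [Fintype A] (Q : S × A → ℝ) :
    l2Norm Q ^ 2 = ∑ p, Q p ^ 2 :=
  Real.sq_sqrt (Finset.sum_nonneg fun _ _ => sq_nonneg _)

lemma boltzmann_nonneg {S A : Type*} [Fintype A] (lam : ℝ) (Q : S × A → ℝ) (s : S) (a : A) :
    0 ≤ boltzmann lam Q s a := by
  unfold boltzmann
  positivity

lemma sum_boltzmann {S A : Type*} [Fintype A] [Nonempty A] (lam : ℝ) (Q : S × A → ℝ) (s : S) :
    ∑ a, boltzmann lam Q s a = 1 := by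
  unfold boltzmann
  rw [← Finset.sum_div]
  exact div_self (Finset.sum_pos (fun _ _ => Real.exp_pos _) Finset.univ_nonempty).ne'

/-- For a row-stochastic matrix `M`, the matrix `(γ M - 1)ᵀ` is bounded below by `1 - γ` in the
`ℓ¹` norm. -/
lemma sum_abs_le_sum_abs_transpose_mulVec {ι : Type*} [Fintype ι] [DecidableEq ι]
    (M : Matrix ι ι ℝ) (hM0 : ∀ i j, 0 ≤ M i j) (hM1 : ∀ i, ∑ j, M i j = 1)
    {γ : ℝ} (hγ0 : 0 ≤ γ) (v : ι → ℝ) :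
    (1 - γ) * ∑ i, |v i| ≤ ∑ j, |((γ • M - 1).transpose.mulVec v) j| := by
  have hentry (j : ι) : ((γ • M - 1).transpose.mulVec v) j = γ * ∑ i, M i j * v i - v j := by
    rw [Matrix.transpose_sub, Matrix.sub_mulVec, Matrix.transpose_one, Matrix.one_mulVec,
      Matrix.transpose_smul, Matrix.smul_mulVec]
    simp [Matrix.mulVec, dotProduct]
  have hpoint (j : ι) : |v j| - γ * ∑ i, M i j * |v i| ≤
      |((γ • M - 1).transpose.mulVec v) j| := by
    have habs : |∑ i, M i j * v i| ≤ ∑ i, M i j * |v i| := by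
      refine (Finset.abs_sum_le_sum_abs _ _).trans_eq (Finset.sum_congr rfl fun i _ => ?_)
      rw [abs_mul, abs_of_nonneg (hM0 i j)]
    have htri := abs_sub_abs_le_abs_sub (v j) (γ * ∑ i, M i j * v i)
    rw [abs_mul, abs_of_nonneg hγ0] at htri
    rw [hentry, abs_sub_comm]
    linarith [mul_le_mul_of_nonneg_left habs hγ0]
  have hmass : ∑ j, ∑ i, M i j * |v i| = ∑ i, |v i| := by
    rw [Finset.sum_comm]
    simp_rw [← Finset.sum_mul, hM1, one_mul]
  calc (1 - γ) * ∑ i, |v i| = ∑ j, (|v j| - γ * ∑ i, M i j * |v i|) := by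
        rw [Finset.sum_sub_distrib, ← Finset.mul_sum, hmass]
        ring
    _ ≤ _ := Finset.sum_le_sum fun j _ => hpoint j

/-- For a row-stochastic matrix `M`, the matrix `(γ M - 1)ᵀ` is bounded below in the
Euclidean norm. -/
lemma sum_sq_le_sum_sq_transpose_mulVec {ι : Type*} [Fintype ι] [DecidableEq ι]
    (M : Matrix ι ι ℝ) (hM0 : ∀ i j, 0 ≤ M i j) (hM1 : ∀ i, ∑ j, M i j = 1)
    {γ : ℝ} (hγ0 : 0 ≤ γ) (hγ1 : γ < 1) (v : ι → ℝ) :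
    (1 - γ) ^ 2 * ∑ i, v i ^ 2 ≤
      Fintype.card ι * ∑ j, ((γ • M - 1).transpose.mulVec v) j ^ 2 := by
  have hsq : ∑ i, v i ^ 2 ≤ (∑ i, |v i|) ^ 2 := by
    simpa using Finset.sum_sq_le_sq_sum_of_nonneg (s := Finset.univ) (f := fun i => |v i|)
      fun i _ => abs_nonneg _
  calc (1 - γ) ^ 2 * ∑ i, v i ^ 2 ≤ (1 - γ) ^ 2 * (∑ i, |v i|) ^ 2 := by gcongr
    _ = ((1 - γ) * ∑ i, |v i|) ^ 2 := by ring
    _ ≤ (∑ j, |((γ • M - 1).transpose.mulVec v) j|) ^ 2 :=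
        pow_le_pow_left₀
          (mul_nonneg (sub_nonneg.2 hγ1.le) (Finset.sum_nonneg fun _ _ => abs_nonneg _))
          (sum_abs_le_sum_abs_transpose_mulVec M hM0 hM1 hγ0 v) 2
    _ ≤ _ := by
        simpa using sq_sum_le_card_mul_sum_sq (s := Finset.univ)
          (f := fun j => |((γ • M - 1).transpose.mulVec v) j|)

theorem stmt18 {S A : Type*} [Fintype S] [Fintype A] [Nonempty S] [Nonempty A]
    [DecidableEq S] [DecidableEq A]
    (P : S → A → S → ℝ) (R : S → A → ℝ) (γ : ℝ)
    (hP0 : ∀ s a s', 0 ≤ P s a s') (hP1 : ∀ s a, ∑ s' : S, P s a s' = 1)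
    (hγ0 : 0 ≤ γ) (hγ1 : γ < 1)
    (lam : ℝ) (hlam : 0 < lam)
    (Qs : S × A → ℝ) (hfix : softT P R γ lam Qs = Qs)
    (C : Set (S × A → ℝ)) (hC : IsCompact C) :
    ∃ L : ℝ, 0 < L ∧ ∀ Q ∈ C,
      (1 / 2) * (l2Norm (fun p => softT P R γ lam Q p - Q p)) ^ 2
        - (1 / 2) * (l2Norm (fun p => softT P R γ lam Qs p - Qs p)) ^ 2
      ≤ L * (l2Norm
          ((γ • Matrix.of (fun p q : S × A => P p.1 p.2 q.1 * boltzmann lam Q q.1 q.2)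
              - (1 : Matrix (S × A) (S × A) ℝ)).transpose.mulVec
            (fun p => softT P R γ lam Q p - Q p))) ^ 2 := by
  have hγ : 0 < 1 - γ := sub_pos.2 hγ1
  refine ⟨Fintype.card (S × A) / (1 - γ) ^ 2, by positivity, fun Q _ => ?_⟩
  have hmain := sum_sq_le_sum_sq_transpose_mulVec
    (Matrix.of fun p q : S × A => P p.1 p.2 q.1 * boltzmann lam Q q.1 q.2)
    (fun p q => mul_nonneg (hP0 _ _ _) (boltzmann_nonneg _ _ _ _))
    (fun p => by
      simp only [Matrix.of_apply]
      rw [Fintype.sum_prod_type]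
      simp_rw [← Finset.mul_sum, sum_boltzmann, mul_one]
      exact hP1 _ _)
    hγ0 hγ1 (fun p => softT P R γ lam Q p - Q p)
  rw [← l2Norm_sq, ← l2Norm_sq, mul_comm, ← le_div_iff₀ (by positivity),
    mul_div_right_comm] at hmain
  linarith [sq_nonneg (l2Norm fun p => softT P R γ lam Q p - Q p),
    sq_nonneg (l2Norm fun p => softT P R γ lam Qs p - Qs p)]
end

section
/- Fix λ > 0 and suppose Q*_λ : S × A → ℝ satisfies F_λ Q*_λ = Q*_λ. Then for every real c, the sublevel set {Q : S × A → ℝ | (1/2)·‖F_λ Q − Q‖₂² ≤ c} is compact; in particular every Q in this set with c ≥ 0 satisfies ‖Q − Q*_λ‖₂ ≤ √(2·n·c)/(1−γ), where n = (card S)·(card A). -/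
theorem norm_le_l2Norm {S A : Type*} [Fintype S] [Fintype A] (Q : S × A → ℝ) :
    ‖Q‖ ≤ l2Norm Q := by
  refine (pi_norm_le_iff_of_nonneg (Real.sqrt_nonneg _)).2 fun p => ?_
  rw [Real.norm_eq_abs]
  exact Real.abs_le_sqrt
    (Finset.single_le_sum (f := fun p => Q p ^ 2) (fun i _ => sq_nonneg (Q i)) (Finset.mem_univ p))

theorem l2Norm_le_sqrt_card_mul_norm {S A : Type*} [Fintype S] [Fintype A] (Q : S × A → ℝ) :
    l2Norm Q ≤ Real.sqrt ((Fintype.card S * Fintype.card A : ℕ) : ℝ) * ‖Q‖ := by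
  refine Real.sqrt_le_iff.2 ⟨by positivity, ?_⟩
  rw [mul_pow, Real.sq_sqrt (Nat.cast_nonneg _)]
  calc ∑ p : S × A, Q p ^ 2 ≤ ∑ _p : S × A, ‖Q‖ ^ 2 := by
        refine Finset.sum_le_sum fun p _ => ?_
        rw [← sq_abs]
        exact pow_le_pow_left₀ (abs_nonneg _) (norm_le_pi_norm Q p) 2
    _ = _ := by simp

theorem mul_log_sum_exp_le_add {A : Type*} [Fintype A] [Nonempty A] {lam d : ℝ} (hlam : 0 < lam)
    {f g : A → ℝ} (h : ∀ a, f a ≤ g a + d) :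
    lam * Real.log (∑ a, Real.exp (f a / lam)) ≤ lam * Real.log (∑ a, Real.exp (g a / lam)) + d := by
  have hpos (u : A → ℝ) : 0 < ∑ a, Real.exp (u a / lam) :=
    Finset.sum_pos (fun a _ => Real.exp_pos _) Finset.univ_nonempty
  have hle : ∑ a, Real.exp (f a / lam) ≤ (∑ a, Real.exp (g a / lam)) * Real.exp (d / lam) := by
    rw [Finset.sum_mul]
    refine Finset.sum_le_sum fun a _ => ?_
    rw [← Real.exp_add, ← add_div]
    gcongr
    exact h a
  have hlog := Real.log_le_log (hpos f) hle
  rw [Real.log_mul (hpos g).ne' (Real.exp_pos _).ne', Real.log_exp] at hlog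
  calc _ ≤ lam * (Real.log (∑ a, Real.exp (g a / lam)) + d / lam) := by gcongr
    _ = _ := by field_simp

theorem softT_apply_le_add {S A : Type*} [Fintype S] [Fintype A] [Nonempty A]
    {P : S → A → S → ℝ} (R : S → A → ℝ) {γ lam d : ℝ}
    (hP0 : ∀ s a s', 0 ≤ P s a s') (hP1 : ∀ s a, ∑ s' : S, P s a s' = 1)
    (hγ0 : 0 ≤ γ) (hlam : 0 < lam) {Q Q' : S × A → ℝ} (h : ∀ p, Q p ≤ Q' p + d) (p : S × A) :
    softT P R γ lam Q p ≤ softT P R γ lam Q' p + γ * d := by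
  have hsum : ∑ s', P p.1 p.2 s' * (lam * Real.log (∑ a', Real.exp (Q (s', a') / lam))) ≤
      ∑ s', P p.1 p.2 s' * (lam * Real.log (∑ a', Real.exp (Q' (s', a') / lam))) + d := by
    calc _ ≤ ∑ s', P p.1 p.2 s' * (lam * Real.log (∑ a', Real.exp (Q' (s', a') / lam)) + d) :=
          Finset.sum_le_sum fun s' _ => mul_le_mul_of_nonneg_left
            (mul_log_sum_exp_le_add hlam fun a' => h (s', a')) (hP0 _ _ _)
      _ = _ := by simp only [mul_add, Finset.sum_add_distrib, ← Finset.sum_mul, hP1, one_mul]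
  have := mul_le_mul_of_nonneg_left hsum hγ0
  simp only [softT]
  linarith

theorem norm_softT_sub_le {S A : Type*} [Fintype S] [Fintype A] [Nonempty A]
    {P : S → A → S → ℝ} (R : S → A → ℝ) {γ lam : ℝ}
    (hP0 : ∀ s a s', 0 ≤ P s a s') (hP1 : ∀ s a, ∑ s' : S, P s a s' = 1)
    (hγ0 : 0 ≤ γ) (hlam : 0 < lam) (Q Q' : S × A → ℝ) :
    ‖softT P R γ lam Q - softT P R γ lam Q'‖ ≤ γ * ‖Q - Q'‖ := by
  refine (pi_norm_le_iff_of_nonneg (by positivity)).2 fun p => ?_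
  have hQ (q : S × A) : |Q q - Q' q| ≤ ‖Q - Q'‖ := norm_le_pi_norm (Q - Q') q
  have h₁ := softT_apply_le_add R hP0 hP1 hγ0 hlam
    (fun q => by linarith [(abs_le.1 (hQ q)).2] : ∀ q, Q q ≤ Q' q + ‖Q - Q'‖) p
  have h₂ := softT_apply_le_add R hP0 hP1 hγ0 hlam
    (fun q => by linarith [(abs_le.1 (hQ q)).1] : ∀ q, Q' q ≤ Q q + ‖Q - Q'‖) p
  rw [Real.norm_eq_abs, Pi.sub_apply, abs_le]
  constructor <;> linarith

theorem continuous_softT {S A : Type*} [Fintype S] [Fintype A] [Nonempty A]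
    {P : S → A → S → ℝ} (R : S → A → ℝ) {γ lam : ℝ}
    (hP0 : ∀ s a s', 0 ≤ P s a s') (hP1 : ∀ s a, ∑ s' : S, P s a s' = 1)
    (hγ0 : 0 ≤ γ) (hlam : 0 < lam) : Continuous (softT P R γ lam) :=
  (LipschitzWith.of_dist_le_mul (K := ⟨γ, hγ0⟩) fun Q Q' => by
    rw [dist_eq_norm, dist_eq_norm]
    exact norm_softT_sub_le R hP0 hP1 hγ0 hlam Q Q').continuous

theorem norm_sub_le_of_residual_le {S A : Type*} [Fintype S] [Fintype A] [Nonempty A]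
    {P : S → A → S → ℝ} {R : S → A → ℝ} {γ lam : ℝ}
    (hP0 : ∀ s a s', 0 ≤ P s a s') (hP1 : ∀ s a, ∑ s' : S, P s a s' = 1)
    (hγ0 : 0 ≤ γ) (hγ1 : γ < 1) (hlam : 0 < lam)
    {Qs : S × A → ℝ} (hfix : softT P R γ lam Qs = Qs) {c : ℝ} {Q : S × A → ℝ}
    (hQ : (1 / 2) * (l2Norm (fun p => softT P R γ lam Q p - Q p)) ^ 2 ≤ c) :
    ‖Q - Qs‖ ≤ Real.sqrt (2 * c) / (1 - γ) := by
  rw [le_div_iff₀ (sub_pos.2 hγ1)]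
  have hres : ‖softT P R γ lam Q - Q‖ ≤ Real.sqrt (2 * c) :=
    (norm_le_l2Norm _).trans ((le_abs_self _).trans (Real.abs_le_sqrt
      (by change l2Norm (fun p => softT P R γ lam Q p - Q p) ^ 2 ≤ _; linarith)))
  have hcontr := norm_softT_sub_le R hP0 hP1 hγ0 hlam Q Qs
  rw [hfix] at hcontr
  have htri := norm_sub_le_norm_sub_add_norm_sub Q (softT P R γ lam Q) Qs
  rw [norm_sub_rev Q (softT P R γ lam Q)] at htri
  linarith

theorem stmt19 {S A : Type*} [Fintype S] [Fintype A] [Nonempty S] [Nonempty A]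
    (P : S → A → S → ℝ) (R : S → A → ℝ) (γ : ℝ)
    (hP0 : ∀ s a s', 0 ≤ P s a s') (hP1 : ∀ s a, ∑ s' : S, P s a s' = 1)
    (hγ0 : 0 ≤ γ) (hγ1 : γ < 1)
    (lam : ℝ) (hlam : 0 < lam)
    (Qs : S × A → ℝ) (hfix : softT P R γ lam Qs = Qs)
    (c : ℝ) :
    IsCompact {Q : S × A → ℝ |
        (1 / 2) * (l2Norm (fun p => softT P R γ lam Q p - Q p)) ^ 2 ≤ c}
    ∧ (0 ≤ c → ∀ Q : S × A → ℝ,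
        (1 / 2) * (l2Norm (fun p => softT P R γ lam Q p - Q p)) ^ 2 ≤ c →
        l2Norm (fun p => Q p - Qs p)
          ≤ Real.sqrt (2 * ((Fintype.card S * Fintype.card A : ℕ) : ℝ) * c) / (1 - γ)) := by
  have hdist {Q : S × A → ℝ}
      (hQ : (1 / 2) * (l2Norm (fun p => softT P R γ lam Q p - Q p)) ^ 2 ≤ c) :
      ‖Q - Qs‖ ≤ Real.sqrt (2 * c) / (1 - γ) :=
    norm_sub_le_of_residual_le hP0 hP1 hγ0 hγ1 hlam hfix hQ
  refine ⟨Metric.isCompact_of_isClosed_isBounded (isClosed_le ?_ continuous_const)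
    ((Metric.isBounded_closedBall (x := Qs) (r := Real.sqrt (2 * c) / (1 - γ))).subset
      fun Q hQ => mem_closedBall_iff_norm.2 (hdist hQ)), fun _ Q hQ => ?_⟩
  · have := continuous_softT R hP0 hP1 hγ0 hlam
    unfold l2Norm
    fun_prop
  · calc l2Norm (fun p => Q p - Qs p)
        ≤ Real.sqrt ((Fintype.card S * Fintype.card A : ℕ) : ℝ) * ‖Q - Qs‖ :=
          l2Norm_le_sqrt_card_mul_norm (Q - Qs)
      _ ≤ Real.sqrt ((Fintype.card S * Fintype.card A : ℕ) : ℝ) *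
          (Real.sqrt (2 * c) / (1 - γ)) := by gcongr; exact hdist hQ
      _ = _ := by
        rw [mul_right_comm 2, mul_comm (2 * c), Real.sqrt_mul (Nat.cast_nonneg _), mul_div_assoc]
end
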